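/- For all ω ∈ (0, π/2), the inequality -ln(cos ω) > ω(1 - cos ω)/sin ω holds. -/

import Mathlib

open Real
theorem stmt0 : ∀ ω : ℝ, 0 < ω → ω < π / 2 →
    -Real.log (Real.cos ω) > ω * (1 - Real.cos ω) / Real.sin ω := by
  intro w h0 h1
  have hc : ∀ x ∈ Set.Ico (0:ℝ) (π/2), 0 < Real.cos x := fun x hx =>
    Real.cos_pos_of_mem_Ioo ⟨by linarith [hx.1, Real.pi_pos], hx.2⟩
  have hd : ∀ x ∈ Set.Ico (0:ℝ) (π/2), HasDerivAt
      (fun x => -Real.log (Real.cos x) - x * Real.sin x / (1 + Real.cos x))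
      ((Real.tan x - x) / (1 + Real.cos x)) x := by
    intro x hx
    have c := hc x hx
    have c1 : 1 + Real.cos x ≠ 0 := by positivity
    have h := (((Real.hasDerivAt_cos x).log c.ne').neg).sub
      (((hasDerivAt_id x).mul (Real.hasDerivAt_sin x)).div
        ((Real.hasDerivAt_cos x).const_add 1) c1)
    refine h.congr_deriv ?_
    rw [Real.tan_eq_sin_div_cos]
    simp only [id, Pi.mul_apply]
    field_simp
    have e : Real.sin x ^ 2 = 1 - Real.cos x ^ 2 := by rw [← Real.sin_sq_add_cos_sq x]; ring
    ring_nf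
    try rw [e]
    try ring
  have hm : StrictMonoOn
      (fun x => -Real.log (Real.cos x) - x * Real.sin x / (1 + Real.cos x))
      (Set.Ico (0:ℝ) (π/2)) := by
    apply strictMonoOn_of_deriv_pos (convex_Ico _ _)
    · exact fun x hx => (hd x hx).continuousAt.continuousWithinAt
    · intro x hx
      rw [interior_Ico] at hx
      have hx' : x ∈ Set.Ico (0:ℝ) (π/2) := ⟨hx.1.le, hx.2⟩
      rw [(hd x hx').deriv]
      have := hc x hx'
      exact div_pos (sub_pos.2 (Real.lt_tan hx.1 hx.2)) (by positivity)
  have h := hm ⟨le_refl 0, by positivity⟩ ⟨h0.le, h1⟩ h0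
  have c := hc w ⟨h0.le, h1⟩
  have s : 0 < Real.sin w := Real.sin_pos_of_pos_of_lt_pi h0 (by linarith [Real.pi_pos])
  have e : w * (1 - Real.cos w) / Real.sin w = w * Real.sin w / (1 + Real.cos w) := by
    rw [div_eq_div_iff s.ne' (by positivity)]
    linear_combination (-w) * Real.sin_sq_add_cos_sq w
  rw [e]
  simp at h
  linarith
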